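/- arXiv:2605.00962 — 3 statements merged into one kernel-verified Lean document; each statement's English description precedes it below -/
import Mathlib

section
/- Let n ≥ 1. Let 𝒢_n = {v : Finset (Fin n) → ℝ : v(∅) = 0} with the symmetric group S_n acting by (σ · v)(S) = v(σ⁻¹(S)), and let ℝ^(Fin n) carry the coordinate-permuting action. Then the vector space of S_n-equivariant linear maps ψ : 𝒢_n → ℝ^(Fin n) has dimension exactly 2n − 1. -/
/-- The space `𝒢_n` of TU-games on `Fin n`: functions `v : Finset (Fin n) → ℝ` with
`v ∅ = 0`. -/
def gameSpace (n : ℕ) : Submodule ℝ (Finset (Fin n) → ℝ) where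
  carrier := {v | v ∅ = 0}
  add_mem' := by
    intro a b ha hb
    simp only [Set.mem_setOf_eq] at *
    simp [ha, hb]
  zero_mem' := by simp
  smul_mem' := by
    intro c v hv
    simp only [Set.mem_setOf_eq] at *
    simp [hv]

/-- The action of `σ ∈ S_n` on games: `(σ • v) S = v (σ⁻¹ S)`. -/
def gamePerm (n : ℕ) (σ : Equiv.Perm (Fin n)) (v : gameSpace n) : gameSpace n :=
  ⟨fun S => v.1 (S.image ⇑σ⁻¹), by
    show v.1 ((∅ : Finset (Fin n)).image ⇑σ⁻¹) = 0
    rw [Finset.image_empty]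
    exact v.2⟩

/-- The space of symmetric linear values: `S_n`-equivariant linear maps
`ψ : 𝒢_n → ℝ^(Fin n)`, where `ℝ^(Fin n)` carries the coordinate-permuting action
`(σ • x) i = x (σ⁻¹ i)`. -/
noncomputable def symValues (n : ℕ) : Submodule ℝ ((gameSpace n) →ₗ[ℝ] (Fin n → ℝ)) where
  carrier := {ψ | ∀ (σ : Equiv.Perm (Fin n)) (v : gameSpace n) (i : Fin n),
    ψ (gamePerm n σ v) i = ψ v (σ⁻¹ i)}
  add_mem' := by
    intro a b ha hb σ v i
    simp [ha σ v i, hb σ v i]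
  zero_mem' := by intro σ v i; simp
  smul_mem' := by
    intro c ψ hψ σ v i
    simp [hψ σ v i]

/-- The orbit label of a pair `(S, i)`: the position of `i` relative to `S`, together with the
size of `S` (shifted by one). -/
def HasLabel {n : ℕ} (S : Finset (Fin n)) (i : Fin n) : Fin n ⊕ Fin (n - 1) → Prop
  | Sum.inl k => i ∈ S ∧ S.card = k + 1
  | Sum.inr k => i ∉ S ∧ S.card = k + 1

lemma HasLabel.nonempty {n : ℕ} {S : Finset (Fin n)} {i : Fin n} {j : Fin n ⊕ Fin (n - 1)}
    (h : HasLabel S i j) : S.Nonempty := by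
  rw [← Finset.card_pos]
  rcases j with k | k <;> simp only [HasLabel] at h <;> omega

lemma HasLabel.unique {n : ℕ} {S : Finset (Fin n)} {i : Fin n} {j j' : Fin n ⊕ Fin (n - 1)}
    (h : HasLabel S i j) (h' : HasLabel S i j') : j = j' := by
  rcases j with k | k <;> rcases j' with k' | k' <;> simp only [HasLabel] at h h'
  · congr 1; ext; omega
  · exact absurd h.1 h'.1
  · exact absurd h'.1 h.1
  · congr 1; ext; omega

lemma exists_hasLabel {n : ℕ} {S : Finset (Fin n)} (hS : S.Nonempty) (i : Fin n) :
    ∃ j, HasLabel S i j := by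
  have hpos := hS.card_pos
  by_cases hi : i ∈ S
  · have hle : S.card ≤ n := by simpa using S.card_le_univ
    exact ⟨Sum.inl ⟨S.card - 1, by omega⟩, hi, by simp only; omega⟩
  · have hlt : S.card < n := by
      simpa using Finset.card_lt_univ_of_notMem hi
    exact ⟨Sum.inr ⟨S.card - 1, by omega⟩, hi, by simp only; omega⟩

lemma exists_finset_hasLabel {n : ℕ} (i : Fin n) (j : Fin n ⊕ Fin (n - 1)) :
    ∃ S, HasLabel S i j := by
  rcases j with k | k
  · obtain ⟨S, hS, -, hc⟩ := Finset.exists_subsuperset_card_eq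
      (Finset.subset_univ ({i} : Finset (Fin n))) (n := k + 1) (by simp)
      (by simp)
    exact ⟨S, hS (Finset.mem_singleton_self i), hc⟩
  · obtain ⟨S, hS, hc⟩ := Finset.exists_subset_card_eq
      (s := ({i}ᶜ : Finset (Fin n))) (n := k + 1)
      (by rw [Finset.card_compl, Finset.card_singleton, Fintype.card_fin]; omega)
    exact ⟨S, fun h => by simpa using hS h, hc⟩

lemma HasLabel.image_iff {n : ℕ} (σ : Equiv.Perm (Fin n)) (S : Finset (Fin n)) (i : Fin n)
    (j : Fin n ⊕ Fin (n - 1)) : HasLabel (S.image σ) (σ i) j ↔ HasLabel S i j := by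
  rcases j with k | k <;>
    simp [HasLabel, Finset.card_image_of_injective S σ.injective]

lemma exists_perm_image_eq {α : Type*} [Fintype α] [DecidableEq α] {S T : Finset α}
    (h : S.card = T.card) : ∃ σ : Equiv.Perm α, S.image σ = T := by
  have e : {x // x ∈ S} ≃ {x // x ∈ T} := Fintype.equivOfCardEq (by simpa using h)
  refine ⟨e.extendSubtype, Finset.eq_of_subset_of_card_le ?_ ?_⟩
  · intro x hx
    obtain ⟨y, hy, rfl⟩ := Finset.mem_image.1 hx
    exact e.extendSubtype_mem y hy
  · rw [Finset.card_image_of_injective _ (Equiv.injective _), h]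

lemma exists_perm_image_eq_apply_eq {α : Type*} [Fintype α] [DecidableEq α] {S T : Finset α}
    {i i' : α} (h : S.card = T.card) (hi : i ∈ S ↔ i' ∈ T) :
    ∃ σ : Equiv.Perm α, S.image σ = T ∧ σ i = i' := by
  obtain ⟨τ, rfl⟩ := exists_perm_image_eq h
  refine ⟨τ.trans (Equiv.swap (τ i) i'), ?_, by simp⟩
  have hmem : τ i ∈ S.image τ ↔ i' ∈ S.image τ := by rw [← hi]; simp
  rw [Equiv.coe_trans, ← Finset.image_image]
  refine Finset.eq_of_subset_of_card_le ?_
    (Finset.card_image_of_injective _ (Equiv.injective _)).ge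
  intro x hx
  obtain ⟨y, hy, rfl⟩ := Finset.mem_image.1 hx
  rw [Equiv.swap_apply_def]
  split_ifs with h1 h2
  · exact hmem.1 (h1 ▸ hy)
  · exact hmem.2 (h2 ▸ hy)
  · exact hy

lemma HasLabel.exists_perm {n : ℕ} {S T : Finset (Fin n)} {i i' : Fin n}
    {j : Fin n ⊕ Fin (n - 1)} (h : HasLabel S i j) (h' : HasLabel T i' j) :
    ∃ σ : Equiv.Perm (Fin n), S.image σ = T ∧ σ i = i' := by
  apply exists_perm_image_eq_apply_eq <;> rcases j with k | k <;>
    simp only [HasLabel] at h h'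
  · omega
  · omega
  · tauto
  · tauto

/-- The Dirac game at `S`, which is zero when `S = ∅`. -/
def diracGame {n : ℕ} (S : Finset (Fin n)) : gameSpace n :=
  ⟨fun T => if T = S ∧ T.Nonempty then 1 else 0, by
    show (if (∅ : Finset (Fin n)) = S ∧ (∅ : Finset (Fin n)).Nonempty then (1 : ℝ) else 0) = 0
    simp⟩

lemma diracGame_empty {n : ℕ} : diracGame (∅ : Finset (Fin n)) = 0 := by
  ext T
  simp only [diracGame, ZeroMemClass.coe_zero, Pi.zero_apply, ite_eq_right_iff]
  rintro ⟨rfl, h⟩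
  simp at h

lemma gamePerm_diracGame {n : ℕ} (σ : Equiv.Perm (Fin n)) (S : Finset (Fin n)) :
    gamePerm n σ (diracGame S) = diracGame (S.image σ) := by
  ext T
  have h : T.image ⇑σ⁻¹ = S ↔ T = S.image σ := by
    constructor
    · rintro rfl
      simp [Finset.image_image, Function.comp_def]
    · rintro rfl
      simp [Finset.image_image, Function.comp_def]
  simp only [gamePerm, diracGame, h, Finset.image_nonempty]

lemma sum_smul_diracGame {n : ℕ} (v : gameSpace n) : ∑ S, v.1 S • diracGame S = v := by
  ext T
  rw [AddSubmonoidClass.coe_finsetSum, Finset.sum_apply]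
  rcases T.eq_empty_or_nonempty with rfl | hT
  · have hv : v.1 ∅ = 0 := v.2
    simp [diracGame, hv]
  · simp [diracGame, hT]

open Classical in
/-- The coefficient of `v S` in the `i`-th coordinate of the value with parameters `c`. -/
noncomputable def labelCoeff {n : ℕ} (c : Fin n ⊕ Fin (n - 1) → ℝ) (S : Finset (Fin n))
    (i : Fin n) : ℝ :=
  ∑ j, if HasLabel S i j then c j else 0

lemma HasLabel.labelCoeff_eq {n : ℕ} (c : Fin n ⊕ Fin (n - 1) → ℝ) {S : Finset (Fin n)}
    {i : Fin n} {j : Fin n ⊕ Fin (n - 1)} (h : HasLabel S i j) : labelCoeff c S i = c j := by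
  classical
  rw [labelCoeff, Finset.sum_eq_single j]
  · rw [if_pos h]
  · intro j' _ hne
    exact if_neg fun h' => hne (h'.unique h)
  · simp

lemma labelCoeff_image {n : ℕ} (c : Fin n ⊕ Fin (n - 1) → ℝ) (σ : Equiv.Perm (Fin n))
    (S : Finset (Fin n)) (i : Fin n) : labelCoeff c (S.image σ) (σ i) = labelCoeff c S i := by
  refine Finset.sum_congr rfl fun j _ => ?_
  congr 1
  exact propext (HasLabel.image_iff σ S i j)

/-- The linear value with parameters `c`. -/
noncomputable def labelValue {n : ℕ} (c : Fin n ⊕ Fin (n - 1) → ℝ) :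
    gameSpace n →ₗ[ℝ] (Fin n → ℝ) where
  toFun v i := ∑ S, v.1 S * labelCoeff c S i
  map_add' v w := by
    ext i
    simp [add_mul, Finset.sum_add_distrib]
  map_smul' r v := by
    ext i
    simp [Finset.mul_sum, mul_assoc]

lemma labelValue_mem_symValues {n : ℕ} (c : Fin n ⊕ Fin (n - 1) → ℝ) :
    labelValue c ∈ symValues n := by
  intro σ v i
  show ∑ S, v.1 (S.image ⇑σ⁻¹) * labelCoeff c S i = ∑ S, v.1 S * labelCoeff c S (σ⁻¹ i)
  refine Fintype.sum_equiv (Equiv.finsetCongr σ⁻¹) _ _ fun S => ?_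
  rw [Equiv.finsetCongr_apply, Finset.map_eq_image]
  congr 1
  exact (labelCoeff_image c σ⁻¹ S i).symm

lemma labelValue_diracGame {n : ℕ} (c : Fin n ⊕ Fin (n - 1) → ℝ) {S : Finset (Fin n)}
    (hS : S.Nonempty) (i : Fin n) : labelValue c (diracGame S) i = labelCoeff c S i := by
  show ∑ T, (if T = S ∧ T.Nonempty then (1 : ℝ) else 0) * labelCoeff c T i = _
  rw [Finset.sum_eq_single S]
  · simp [hS]
  · intro T _ hT
    simp [hT]
  · simp

/-- Evaluation of symmetric values at the Dirac games of a family of coalitions, in the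
coordinate `i`. -/
def evalDirac {n : ℕ} {ι : Type*} (i : Fin n) (R : ι → Finset (Fin n)) :
    symValues n →ₗ[ℝ] (ι → ℝ) where
  toFun ψ j := ψ.1 (diracGame (R j)) i
  map_add' ψ φ := by ext j; simp
  map_smul' r ψ := by ext j; simp

lemma evalDirac_bijective {n : ℕ} (i : Fin n) {R : Fin n ⊕ Fin (n - 1) → Finset (Fin n)}
    (hR : ∀ j, HasLabel (R j) i j) : Function.Bijective (evalDirac i R) := by
  constructor
  · rw [injective_iff_map_eq_zero]
    intro ψ hψ
    have hdirac : ∀ T, ψ.1 (diracGame T) = 0 := by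
      intro T
      rcases T.eq_empty_or_nonempty with rfl | hT
      · rw [diracGame_empty, map_zero]
      ext i'
      obtain ⟨j, hj⟩ := exists_hasLabel hT i'
      obtain ⟨σ, rfl, rfl⟩ := (hR j).exists_perm hj
      rw [← gamePerm_diracGame, ψ.2 σ, show σ⁻¹ (σ i) = i from σ.symm_apply_apply i]
      exact congrFun hψ j
    ext1
    refine LinearMap.ext fun v => ?_
    rw [← sum_smul_diracGame v]
    simp [hdirac]
  · intro c
    refine ⟨⟨labelValue c, labelValue_mem_symValues c⟩, funext fun j => ?_⟩
    exact (labelValue_diracGame c (hR j).nonempty i).trans ((hR j).labelCoeff_eq c)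

/-- For `n ≥ 1`, the space of `S_n`-equivariant linear maps
`𝒢_n → ℝ^(Fin n)` has dimension exactly `2n - 1`. -/
theorem symValues_dim (n : ℕ) (hn : 1 ≤ n) :
    Module.finrank ℝ (symValues n) = 2 * n - 1 := by
  choose R hR using exists_finset_hasLabel (⟨0, hn⟩ : Fin n)
  rw [(LinearEquiv.ofBijective _ (evalDirac_bijective _ hR)).finrank_eq, Module.finrank_pi,
    Fintype.card_sum, Fintype.card_fin, Fintype.card_fin]
  omega
end

section
/- Let n ≥ 1 and let ψ : 𝒢_n → ℝ^(Fin n) be any S_n-equivariant linear map, where 𝒢_n = {v : Finset (Fin n) → ℝ : v(∅) = 0} carries the action (σ · v)(S) = v(σ⁻¹(S)) and ℝ^(Fin n) the coordinate-permuting action. Suppose v ∈ 𝒢_n satisfies: for every 1 ≤ k ≤ n and every player i ∈ Fin n, the sum of v(S) over all k-element subsets S containing i is zero. Then ψ(v) = 0. -/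
/-- Two finsets of equal cardinality which agree about membership of `i` are related by a
permutation fixing `i`. -/
theorem Equiv.Perm.exists_image_eq_of_card_eq {α : Type*} [Fintype α] [DecidableEq α] {i : α}
    {S T : Finset α} (hc : S.card = T.card) (hi : i ∈ S ↔ i ∈ T) :
    ∃ σ : Equiv.Perm α, σ i = i ∧ S.image σ = T := by
  let e : {x // x ∈ S} ≃ {x // x ∈ T} := Finset.equivOfCardEq hc
  have hmem (x : α) : e.extendSubtype x ∈ T ↔ x ∈ S := by
    by_cases hx : x ∈ S
    · simp [hx, e.extendSubtype_mem x hx]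
    · simp [hx, e.extendSubtype_not_mem x hx]
  have hswap (x : α) : Equiv.swap (e.extendSubtype i) i x ∈ T ↔ x ∈ T := by
    have h := hmem i
    rw [Equiv.swap_apply_def]
    split_ifs <;> simp_all
  refine ⟨e.extendSubtype.trans (Equiv.swap (e.extendSubtype i) i), by simp, ?_⟩
  refine Finset.eq_of_subset_of_card_le ?_ ?_
  · intro y hy
    obtain ⟨x, hx, rfl⟩ := Finset.mem_image.1 hy
    exact (hswap _).2 ((hmem x).2 hx)
  · rw [Finset.card_image_of_injective _ (Equiv.injective _), hc]

/-- A function on finsets whose sum over the `k`-element sets containing `i` vanishes for every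
`i` sums to zero over all `k`-element sets, provided `k ≠ 0`. -/
theorem Finset.sum_card_eq_zero_of_sum_mem_eq_zero {α : Type*} [Fintype α] [DecidableEq α]
    {f : Finset α → ℝ} {k : ℕ} (hk : k ≠ 0)
    (hf : ∀ i, ∑ S ∈ univ.filter (fun S : Finset α => S.card = k ∧ i ∈ S), f S = 0) :
    ∑ S ∈ univ.filter (fun S : Finset α => S.card = k), f S = 0 := by
  have h : ∑ i, ∑ S ∈ univ.filter (fun S : Finset α => S.card = k ∧ i ∈ S), f S =
      k * ∑ S ∈ univ.filter (fun S : Finset α => S.card = k), f S := by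
    simp_rw [← Finset.filter_filter, Finset.sum_filter _ (fun S : Finset α => f S)]
    simp_rw [Finset.sum_filter]
    rw [Finset.sum_comm, Finset.mul_sum]
    refine Finset.sum_congr rfl fun S _ => ?_
    split_ifs with hS
    · simp [hS]
    · simp
  rw [Finset.sum_eq_zero fun i _ => hf i] at h
  simpa [hk] using h.symm

/-- If `f` sums to zero over the finsets which have the size of `S` and agree with `S` about
membership of `i`, then the sum of `f` over the translates of `S` by the stabilizer of `i`
vanishes. -/
theorem sum_stabilizer_image_eq_zero {α : Type*} [Fintype α] [DecidableEq α] (i : α)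
    (f : Finset α → ℝ) (S : Finset α)
    (hf : ∑ T ∈ Finset.univ.filter (fun T : Finset α => T.card = S.card ∧ (i ∈ T ↔ i ∈ S)),
      f T = 0) :
    ∑ σ ∈ Finset.univ.filter (fun σ : Equiv.Perm α => σ i = i), f (S.image ⇑σ⁻¹) = 0 := by
  set G := Finset.univ.filter (fun σ : Equiv.Perm α => σ i = i) with hG
  set C := Finset.univ.filter (fun T : Finset α => T.card = S.card ∧ (i ∈ T ↔ i ∈ S)) with hC
  have hconst : ∀ T ∈ C, ∑ σ ∈ G, f (T.image ⇑σ⁻¹) = ∑ σ ∈ G, f (S.image ⇑σ⁻¹) := by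
    intro T hT
    simp only [hC, Finset.mem_filter, Finset.mem_univ, true_and] at hT
    obtain ⟨τ, hτ, rfl⟩ := Equiv.Perm.exists_image_eq_of_card_eq hT.1.symm hT.2.symm
    refine Finset.sum_equiv (Equiv.mulLeft τ⁻¹) (fun σ => ?_) (fun σ _ => ?_)
    · have hτ' : τ.symm (σ i) = i ↔ σ i = i := by rw [Equiv.symm_apply_eq, hτ]
      simp [hG, hτ']
    · simp [Finset.image_image, Function.comp_def]
  have hinv : ∀ σ ∈ G, ∑ T ∈ C, f (T.image ⇑σ⁻¹) = 0 := by
    intro σ hσ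
    rw [← hf]
    have hσi : σ i = i := by simpa [hG] using hσ
    refine Finset.sum_equiv (Equiv.finsetCongr σ⁻¹) (fun T => ?_) (fun T _ => ?_)
    · have hσ' : (σ⁻¹).symm i = i := hσi
      simp [hC, hσ']
    · simp [Equiv.finsetCongr, Finset.map_eq_image]
  have hsum : (C.card : ℝ) * ∑ σ ∈ G, f (S.image ⇑σ⁻¹) = 0 := by
    rw [← nsmul_eq_mul, ← Finset.sum_const, ← Finset.sum_congr rfl hconst, Finset.sum_comm]
    exact Finset.sum_eq_zero hinv
  have hS : S ∈ C := by simp [hC]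
  exact (mul_eq_zero.1 hsum).resolve_left (Nat.cast_ne_zero.2 (Finset.card_ne_zero_of_mem hS))

/-- **Proposition 5.1.** Every symmetric linear value vanishes on the
kernel `W`: if `ψ : 𝒢_n → ℝ^(Fin n)` is an `S_n`-equivariant linear map and `v` is a game
such that for every coalition size `1 ≤ k ≤ n` and every player `i`, the sum of `v S` over
all `k`-element coalitions `S` containing `i` vanishes, then `ψ v = 0`. -/
theorem symValue_vanishes_on_kernel (n : ℕ) (hn : 1 ≤ n)
    (ψ : (gameSpace n) →ₗ[ℝ] (Fin n → ℝ))
    (hψ : ∀ (σ : Equiv.Perm (Fin n)) (v : gameSpace n) (i : Fin n),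
      ψ (gamePerm n σ v) i = ψ v (σ⁻¹ i))
    (v : gameSpace n)
    (hv : ∀ k : ℕ, 1 ≤ k → k ≤ n → ∀ i : Fin n,
      ∑ S ∈ Finset.univ.filter (fun S : Finset (Fin n) => S.card = k ∧ i ∈ S), v.1 S = 0) :
    ψ v = 0 := by
  ext i
  have hzero : ∑ σ ∈ Finset.univ.filter (fun σ : Equiv.Perm (Fin n) => σ i = i),
      gamePerm n σ v = 0 := by
    ext S
    rw [AddSubmonoidClass.coe_finsetSum, Finset.sum_apply]
    change ∑ σ ∈ Finset.univ.filter (fun σ : Equiv.Perm (Fin n) => σ i = i),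
      v.1 (S.image ⇑σ⁻¹) = 0
    rcases S.eq_empty_or_nonempty with rfl | hS
    · have h0 : v.1 ∅ = 0 := v.2
      simp [h0]
    have hv' := hv S.card hS.card_pos (by simpa using S.card_le_univ)
    apply sum_stabilizer_image_eq_zero
    by_cases hi : i ∈ S
    · simpa [hi] using hv' i
    · have h := Finset.sum_card_eq_zero_of_sum_mem_eq_zero hS.card_pos.ne' hv'
      rw [← Finset.sum_filter_add_sum_filter_not _ (fun T => i ∈ T), Finset.filter_filter,
        Finset.filter_filter, hv' i, zero_add] at h
      simpa [hi] using h
  have hsum := congrFun (congrArg ψ hzero) i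
  rw [map_sum, Finset.sum_apply, map_zero, Finset.sum_congr rfl (g := fun _ => ψ v i),
    Finset.sum_const, nsmul_eq_mul] at hsum
  · refine (mul_eq_zero.1 hsum).resolve_left (Nat.cast_ne_zero.2 ?_)
    exact Finset.card_ne_zero_of_mem (a := 1) (by simp)
  · intro σ hσ
    have hσi : σ i = i := by simpa using hσ
    rw [hψ, Equiv.Perm.inv_eq_iff_eq.2 hσi.symm]
end

section
/- Fix n_L ≥ 1. For each n_R ≥ 1, consider the glove game on N = Fin (n_L + n_R) in which L is a fixed n_L-element subset of N, R is its complement, and v(S) = min(|S ∩ L|, |S ∩ R|). Let r(n_R) denote the Shapley value φ_i(v) of any right holder i ∈ R (all such values are equal, by symmetry among the members of R), where φ_i(v) = Σ_{S ⊆ N \ {i}} (|S|! (n − |S| − 1)! / n!) · (v(S ∪ {i}) − v(S)) with n = n_L + n_R. Then r(n_R) → 0 as n_R → ∞. -/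
/-- The Shapley value of player `i` in the TU-game `v` on `Fin n`:
`φ_i(v) = ∑_{S ⊆ N \ {i}} (|S|! (n - |S| - 1)! / n!) (v (S ∪ {i}) - v S)`. -/
noncomputable def shapley (n : ℕ) (v : Finset (Fin n) → ℝ) (i : Fin n) : ℝ :=
  ∑ S ∈ (Finset.univ.erase i).powerset,
    ((S.card.factorial * (n - S.card - 1).factorial : ℕ) : ℝ) / (n.factorial : ℝ) *
      (v (insert i S) - v S)

/-- The glove game on `Fin (nL + nR)` with left holders `L` (right holders are the
complement `Lᶜ`): `v S = min (|S ∩ L|) (|S ∩ Lᶜ|)`. -/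
noncomputable def gloveGame (n : ℕ) (L : Finset (Fin n)) (S : Finset (Fin n)) : ℝ :=
  ((min (S ∩ L).card (S ∩ Lᶜ).card : ℕ) : ℝ)

/-- A right holder's marginal contribution lies in `[0, 1]`, and it vanishes on coalitions with at
least twice as many members as there are left holders. -/
theorem abs_gloveGame_insert_sub_le {n : ℕ} {L S : Finset (Fin n)} {i : Fin n}
    (hi : i ∉ L) (hS : i ∉ S) :
    |gloveGame n L (insert i S) - gloveGame n L S| ≤ if S.card < 2 * L.card then 1 else 0 := by
  have hl : insert i S ∩ L = S ∩ L := Finset.insert_inter_of_notMem hi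
  have hr : (insert i S ∩ Lᶜ).card = (S ∩ Lᶜ).card + 1 := by
    rw [Finset.insert_inter_of_mem (Finset.mem_compl.2 hi), Finset.card_insert_of_notMem]
    simp [hS]
  have hsum : (S ∩ L).card + (S ∩ Lᶜ).card = S.card := by
    rw [← Finset.sdiff_eq_inter_compl, Finset.card_inter_add_card_sdiff]
  have hle : (S ∩ L).card ≤ L.card := Finset.card_le_card Finset.inter_subset_right
  unfold gloveGame
  rw [hl, hr]
  split_ifs with h
  · have h₁ : min (S ∩ L).card (S ∩ Lᶜ).card ≤ min (S ∩ L).card ((S ∩ Lᶜ).card + 1) := by omega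
    have h₂ : min (S ∩ L).card ((S ∩ Lᶜ).card + 1) ≤ min (S ∩ L).card (S ∩ Lᶜ).card + 1 := by
      omega
    rw [abs_of_nonneg (sub_nonneg.2 (by exact_mod_cast h₁)), sub_le_iff_le_add']
    exact_mod_cast h₂
  · rw [min_eq_left (by omega : (S ∩ L).card ≤ (S ∩ Lᶜ).card + 1),
      min_eq_left (by omega : (S ∩ L).card ≤ (S ∩ Lᶜ).card), sub_self, abs_zero]

/-- In the Shapley value, the coalitions of any given size carry total weight `1 / n`. -/
theorem choose_mul_shapley_weight {n s : ℕ} (hs : s < n) :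
    ((n - 1).choose s : ℝ) *
      (((s.factorial * (n - s - 1).factorial : ℕ) : ℝ) / (n.factorial : ℝ)) = 1 / n := by
  obtain ⟨m, rfl⟩ : ∃ m, n = m + 1 := ⟨n - 1, by omega⟩
  have h := Nat.choose_mul_factorial_mul_factorial (Nat.lt_succ_iff.1 hs)
  rw [show m + 1 - s - 1 = m - s by omega, Nat.add_sub_cancel, Nat.factorial_succ, ← mul_div_assoc,
    div_eq_div_iff (by positivity) (by positivity)]
  norm_cast
  rw [← mul_assoc, h]
  ring

/-- A right holder's Shapley value in the glove game is at most `2 * |L| / n`. -/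
theorem abs_shapley_gloveGame_le {n : ℕ} {L : Finset (Fin n)} {i : Fin n} (hi : i ∉ L) :
    |shapley n (gloveGame n L) i| ≤ 2 * L.card / n := by
  have hn : 0 < n := i.pos
  have hcard : (Finset.univ.erase i).card = n - 1 := by simp
  let f : ℕ → ℝ := fun s ↦ ((s.factorial * (n - s - 1).factorial : ℕ) : ℝ) / (n.factorial : ℝ) *
    if s < 2 * L.card then 1 else 0
  calc |shapley n (gloveGame n L) i|
      ≤ ∑ S ∈ (Finset.univ.erase i).powerset, f S.card := by
        refine (Finset.abs_sum_le_sum_abs _ _).trans (Finset.sum_le_sum fun S hS ↦ ?_)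
        rw [abs_mul, abs_of_nonneg (by positivity)]
        have hiS : i ∉ S := fun h ↦ by simpa using Finset.mem_powerset.1 hS h
        exact mul_le_mul_of_nonneg_left (abs_gloveGame_insert_sub_le hi hiS) (by positivity)
    _ = ∑ s ∈ Finset.range n, if s < 2 * L.card then (1 / n : ℝ) else 0 := by
        rw [Finset.sum_powerset_apply_card, hcard, Nat.sub_add_cancel hn]
        refine Finset.sum_congr rfl fun s hs ↦ ?_
        rw [nsmul_eq_mul, ← mul_assoc, choose_mul_shapley_weight (Finset.mem_range.1 hs), mul_ite,
          mul_one, mul_zero]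
    _ ≤ 2 * L.card / n := by
        rw [← Finset.sum_filter, Finset.sum_const, nsmul_eq_mul, mul_one_div]
        gcongr
        have h : (Finset.range n).filter (· < 2 * L.card) ⊆ Finset.range (2 * L.card) :=
          fun s hs ↦ Finset.mem_range.2 (Finset.mem_filter.1 hs).2
        exact_mod_cast (Finset.card_le_card h).trans_eq (Finset.card_range _)

/-- Fix `nL ≥ 1`. In the glove game on `nL + nR` players with `nL` left
holders, the (common) Shapley value of a right holder tends to `0` as `nR → ∞`: for every
`ε > 0` there is `N` such that for all `nR ≥ max N 1`, every `nL`-element set `L` of left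
holders and every right holder `i ∉ L`, the Shapley value of `i` is smaller than `ε` in
absolute value. -/
theorem glove_rightHolder_shapley_tendsto_zero (nL : ℕ) (hL : 1 ≤ nL) :
    ∀ ε : ℝ, 0 < ε → ∃ N : ℕ, ∀ nR : ℕ, 1 ≤ nR → N ≤ nR →
      ∀ L : Finset (Fin (nL + nR)), L.card = nL →
        ∀ i : Fin (nL + nR), i ∉ L →
          |shapley (nL + nR) (gloveGame (nL + nR) L) i| < ε := by
  intro ε hε
  obtain ⟨N, hN⟩ := exists_nat_gt (2 * nL / ε)
  refine ⟨N, fun nR hR hNR L hcard i hi ↦ (abs_shapley_gloveGame_le hi).trans_lt ?_⟩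
  have hn : (N : ℝ) ≤ ((nL + nR : ℕ) : ℝ) := by exact_mod_cast hNR.trans (Nat.le_add_left _ _)
  have hpos : (0 : ℝ) < ((nL + nR : ℕ) : ℝ) := by exact_mod_cast (by omega : 0 < nL + nR)
  rw [hcard, div_lt_iff₀ hpos, ← div_lt_iff₀' hε]
  exact hN.trans_le hn
end
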